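/- For every w ∈ B_n whose long one-line notation avoids the patterns 3412 and 4231, there exists v ∈ B_n whose window avoids the five signed patterns 1 2̄, 2̄ 1, 2̄ 1̄, 3 1 2, 3 1̄ 2 such that for every function θ : B_n → ℂ that is constant on conjugacy classes, Σ_{u ≤ w} θ(u) = Σ_{u ≤ v} θ(u), where both sums are over the Bruhat intervals {u ∈ B_n : u ≤ w} and {u ∈ B_n : u ≤ v}. (Equivalently, the Kazhdan–Lusztig elements C'_w(1) = Σ_{u ≤ w} u and C'_v(1) = Σ_{u ≤ v} u of ℤ[B_n] agree under every trace of ℤ[B_n].) -/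

import Mathlib

open scoped BigOperators

/-- Membership in the hyperoctahedral group `B_n`, viewed as permutations `w` of `ℤ`
satisfying `w (-i) = - w i` and fixing everything outside `{-n, …, -1, 1, …, n}`. -/
def IsBn (n : ℕ) (w : Equiv.Perm ℤ) : Prop :=
  (∀ i : ℤ, w (-i) = - w i) ∧ ∀ i : ℤ, (n : ℤ) < |i| → w i = i

/-- The window of `w` avoids the signed pattern `1 2̄`. -/
def Avoids12bar (n : ℕ) (w : Equiv.Perm ℤ) : Prop :=
  ¬ ∃ i j : ℤ, 1 ≤ i ∧ i < j ∧ j ≤ (n : ℤ) ∧ 0 < w i ∧ w j < 0 ∧ w i < -(w j)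

/-- The window of `w` avoids the signed pattern `2̄ 1`. -/
def Avoids2bar1 (n : ℕ) (w : Equiv.Perm ℤ) : Prop :=
  ¬ ∃ i j : ℤ, 1 ≤ i ∧ i < j ∧ j ≤ (n : ℤ) ∧ w i < 0 ∧ 0 < w j ∧ w j < -(w i)

/-- The window of `w` avoids the signed pattern `2̄ 1̄`. -/
def Avoids2bar1bar (n : ℕ) (w : Equiv.Perm ℤ) : Prop :=
  ¬ ∃ i j : ℤ, 1 ≤ i ∧ i < j ∧ j ≤ (n : ℤ) ∧ w i < w j ∧ w j < 0

/-- The window of `w` avoids the signed pattern `3 1 2`. -/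
def Avoids312s (n : ℕ) (w : Equiv.Perm ℤ) : Prop :=
  ¬ ∃ i j k : ℤ, 1 ≤ i ∧ i < j ∧ j < k ∧ k ≤ (n : ℤ) ∧ 0 < w j ∧ w j < w k ∧ w k < w i

/-- The window of `w` avoids the signed pattern `3 1̄ 2`. -/
def Avoids31bar2 (n : ℕ) (w : Equiv.Perm ℤ) : Prop :=
  ¬ ∃ i j k : ℤ, 1 ≤ i ∧ i < j ∧ j < k ∧ k ≤ (n : ℤ) ∧
    w j < 0 ∧ 0 < w k ∧ w k < w i ∧ -(w j) < w k

/-- The window of `w` avoids the five signed patterns `1 2̄`, `2̄ 1`, `2̄ 1̄`, `3 1 2`, `3 1̄ 2`. -/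
def AvoidsFive (n : ℕ) (w : Equiv.Perm ℤ) : Prop :=
  Avoids12bar n w ∧ Avoids2bar1 n w ∧ Avoids2bar1bar n w ∧ Avoids312s n w ∧ Avoids31bar2 n w

/-- The long one-line notation `(w(-n), …, w(-1), w(1), …, w(n))` avoids the pattern `3412`. -/
def LongAvoids3412 (n : ℕ) (w : Equiv.Perm ℤ) : Prop :=
  ¬ ∃ i1 i2 i3 i4 : ℤ, -(n : ℤ) ≤ i1 ∧ i1 < i2 ∧ i2 < i3 ∧ i3 < i4 ∧ i4 ≤ (n : ℤ) ∧
    i1 ≠ 0 ∧ i2 ≠ 0 ∧ i3 ≠ 0 ∧ i4 ≠ 0 ∧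
    w i3 < w i4 ∧ w i4 < w i1 ∧ w i1 < w i2

/-- The long one-line notation `(w(-n), …, w(-1), w(1), …, w(n))` avoids the pattern `4231`. -/
def LongAvoids4231 (n : ℕ) (w : Equiv.Perm ℤ) : Prop :=
  ¬ ∃ i1 i2 i3 i4 : ℤ, -(n : ℤ) ≤ i1 ∧ i1 < i2 ∧ i2 < i3 ∧ i3 < i4 ∧ i4 ≤ (n : ℤ) ∧
    i1 ≠ 0 ∧ i2 ≠ 0 ∧ i3 ≠ 0 ∧ i4 ≠ 0 ∧
    w i4 < w i2 ∧ w i2 < w i3 ∧ w i3 < w i1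

/-- The Coxeter generators of `B_n` inside `Equiv.Perm ℤ`: the element `t` interchanging
`1` and `-1`, and the elements `s_i = (i, i+1)(-i, -(i+1))` for `1 ≤ i ≤ n - 1`. -/
def bGen (n : ℕ) : Set (Equiv.Perm ℤ) :=
  {x | x = Equiv.swap 1 (-1) ∨
    ∃ i : ℤ, 1 ≤ i ∧ i ≤ (n : ℤ) - 1 ∧ x = Equiv.swap i (i + 1) * Equiv.swap (-i) (-(i + 1))}

/-- The `2n - 1` adjacent transpositions of the symmetric group on
`{-n, …, -1, 1, …, n}` (with the linear order `-n < ⋯ < -1 < 1 < ⋯ < n`). -/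
def sGen (n : ℕ) : Set (Equiv.Perm ℤ) :=
  {x | ∃ i : ℤ, -(n : ℤ) ≤ i ∧ i ≤ (n : ℤ) - 1 ∧ i ≠ 0 ∧
    x = Equiv.swap i (if i = -1 then 1 else i + 1)}

/-- `l` is a reduced word for `w` with respect to the generating set `S`:
its letters lie in `S`, its product is `w`, and it has minimal length among such words. -/
def IsReducedWord (S : Set (Equiv.Perm ℤ)) (l : List (Equiv.Perm ℤ)) (w : Equiv.Perm ℤ) :
    Prop :=
  (∀ x ∈ l, x ∈ S) ∧ l.prod = w ∧
    ∀ l' : List (Equiv.Perm ℤ), (∀ x ∈ l', x ∈ S) → l'.prod = w → l.length ≤ l'.length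

/-- Bruhat order with respect to the generating set `S`: `v ≤ w` iff some reduced word
for `w` contains a reduced word for `v` as a (not-necessarily-contiguous) subsequence. -/
def BruhatLe (S : Set (Equiv.Perm ℤ)) (v w : Equiv.Perm ℤ) : Prop :=
  ∃ lw lv : List (Equiv.Perm ℤ), IsReducedWord S lw w ∧ IsReducedWord S lv v ∧ lv.Sublist lw

namespace BH

/-- The reflection exchanging `p, q` and `-p, -q`. -/
def rf (p q : ℤ) : Equiv.Perm ℤ :=
  if p = -q then Equiv.swap p q else Equiv.swap p q * Equiv.swap (-p) (-q)

theorem rf_apply {p q : ℤ} (hp : p ≠ 0) (hq : q ≠ 0) (x : ℤ) :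
    rf p q x = if x = p then q else if x = q then p else if x = -p then -q
      else if x = -q then -p else x := by
  unfold rf
  split_ifs <;> simp only [Equiv.Perm.mul_apply, Equiv.swap_apply_def] <;> grind

theorem rf_odd {p q : ℤ} (hp : p ≠ 0) (hq : q ≠ 0) (x : ℤ) : rf p q (-x) = - rf p q x := by
  rw [rf_apply hp hq, rf_apply hp hq]; grind

theorem rf_self {p : ℤ} (hp : p ≠ 0) : rf p p = 1 := by
  ext x; rw [rf_apply hp hp]; simp; grind

theorem rf_mul_self {p q : ℤ} (hp : p ≠ 0) (hq : q ≠ 0) : rf p q * rf p q = 1 := by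
  ext x; rw [Equiv.Perm.mul_apply, rf_apply hp hq, rf_apply hp hq]; simp; grind

theorem rf_inv {p q : ℤ} (hp : p ≠ 0) (hq : q ≠ 0) : (rf p q)⁻¹ = rf p q :=
  inv_eq_of_mul_eq_one_left (rf_mul_self hp hq)

theorem rf_left {p q : ℤ} (hp : p ≠ 0) (hq : q ≠ 0) : rf p q p = q := by
  rw [rf_apply hp hq]; simp

theorem rf_right {p q : ℤ} (hp : p ≠ 0) (hq : q ≠ 0) : rf p q q = p := by
  rw [rf_apply hp hq]; grind

theorem odd_ne {y : Equiv.Perm ℤ} (hy : ∀ i, y (-i) = - y i) {p : ℤ} (hp : p ≠ 0) : y p ≠ 0 := by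
  intro h
  have h0 : y 0 = 0 := by have := hy 0; simp at this; omega
  exact hp (y.injective (h.trans h0.symm))

theorem conj_rf {y : Equiv.Perm ℤ} (hy : ∀ i, y (-i) = - y i) {p q : ℤ} (hp : p ≠ 0)
    (hq : q ≠ 0) : y * rf p q = rf (y p) (y q) * y := by
  ext x
  rw [Equiv.Perm.mul_apply, Equiv.Perm.mul_apply, rf_apply hp hq,
    rf_apply (odd_ne hy hp) (odd_ne hy hq)]
  rw [← hy p, ← hy q]
  simp only [y.injective.eq_iff]
  split_ifs <;> rfl

/-- Simple pairs. -/
def sp (n : ℕ) (p q : ℤ) : Prop := (p = -1 ∧ q = 1) ∨ (1 ≤ p ∧ q = p + 1 ∧ q ≤ n)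

theorem sp_ne {n : ℕ} {p q : ℤ} (h : sp n p q) : p < q ∧ p ≠ 0 ∧ q ≠ 0 := by
  unfold sp at h; omega

theorem mem_gen {n : ℕ} {a : Equiv.Perm ℤ} :
    a ∈ bGen n ↔ ∃ p q, sp n p q ∧ a = rf p q := by
  have ht : Equiv.swap (1 : ℤ) (-1) = rf (-1) 1 := by
    unfold rf; rw [if_pos rfl, Equiv.swap_comm]
  have hs : ∀ i : ℤ, 1 ≤ i → Equiv.swap i (i + 1) * Equiv.swap (-i) (-(i + 1)) = rf i (i+1) := by
    intro i hi; unfold rf; rw [if_neg (by omega)]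
  constructor
  · rintro (rfl | ⟨i, h1, h2, rfl⟩)
    · exact ⟨-1, 1, Or.inl ⟨rfl, rfl⟩, ht⟩
    · exact ⟨i, i+1, Or.inr ⟨h1, rfl, by omega⟩, hs i h1⟩
  · rintro ⟨p, q, (⟨rfl, rfl⟩ | ⟨h1, rfl, h2⟩), rfl⟩
    · exact Or.inl ht.symm
    · exact Or.inr ⟨p, h1, by omega, (hs p h1).symm⟩

theorem sp_inv {n : ℕ} {p q : ℤ} (h : sp n p q) {x y : ℤ} (hxy : x < y) (hx : x ≠ 0) (hy : y ≠ 0)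
    (hi : rf p q y < rf p q x) : rf p q = rf x y := by
  obtain ⟨h1, h2, h3⟩ := sp_ne h
  have key : (x = p ∧ y = q) ∨ (x = -q ∧ y = -p) := by
    rw [rf_apply h2 h3, rf_apply h2 h3] at hi
    unfold sp at h
    grind
  rcases key with ⟨rfl, rfl⟩ | ⟨rfl, rfl⟩
  · rfl
  · ext z; rw [rf_apply h2 h3, rf_apply hx hy]; grind

theorem gen_odd {n : ℕ} (l : List (Equiv.Perm ℤ)) (hl : ∀ x ∈ l, x ∈ bGen n) (i : ℤ) :
    l.prod (-i) = - l.prod i := by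
  induction l with
  | nil => simp
  | cons a l ih =>
    obtain ⟨p, q, h, rfl⟩ := mem_gen.1 (hl a (by simp))
    obtain ⟨_, h2, h3⟩ := sp_ne h
    rw [List.prod_cons, Equiv.Perm.mul_apply, Equiv.Perm.mul_apply,
      ih (fun x hx => hl x (by simp [hx])), rf_odd h2 h3]

/-- Strong exchange. -/
theorem exch {n : ℕ} (l : List (Equiv.Perm ℤ)) (hl : ∀ x ∈ l, x ∈ bGen n) {p q : ℤ}
    (hpq : p < q) (hp : p ≠ 0) (hq : q ≠ 0) (hi : l.prod q < l.prod p) :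
    ∃ l' : List (Equiv.Perm ℤ), l'.Sublist l ∧ l'.length < l.length ∧
      l'.prod = l.prod * rf p q := by
  induction l with
  | nil => simp at hi; omega
  | cons a l ih =>
    have hl' : ∀ x ∈ l, x ∈ bGen n := fun x hx => hl x (by simp [hx])
    have ho := gen_odd l hl'
    by_cases h : l.prod q < l.prod p
    · obtain ⟨l', h1, h2, h3⟩ := ih hl' h
      exact ⟨a :: l', h1.cons_cons a, by simpa using h2, by simp [h3, mul_assoc]⟩
    · have hne : l.prod p ≠ l.prod q := fun hh => by
        have := l.prod.injective hh; omega
      have hlt : l.prod p < l.prod q := by omega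
      obtain ⟨x, y, hs, rfl⟩ := mem_gen.1 (hl a (by simp))
      rw [List.prod_cons, Equiv.Perm.mul_apply, Equiv.Perm.mul_apply] at hi
      have := sp_inv hs hlt (odd_ne ho hp) (odd_ne ho hq) hi
      refine ⟨l, List.sublist_cons_self _ _, by simp, ?_⟩
      obtain ⟨_, h2, h3⟩ := sp_ne hs
      rw [List.prod_cons, mul_assoc, conj_rf ho hp hq, ← this, ← mul_assoc, rf_mul_self h2 h3,
        one_mul]

/-- One step up in Bruhat order. -/
def Up (u w : Equiv.Perm ℤ) : Prop :=
  ∃ p q : ℤ, p < q ∧ p ≠ 0 ∧ q ≠ 0 ∧ u p < u q ∧ w = u * rf p q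

/-- Bruhat order via reflections. -/
def Le : Equiv.Perm ℤ → Equiv.Perm ℤ → Prop := Relation.ReflTransGen Up

theorem Le_sub {n : ℕ} {u w : Equiv.Perm ℤ} (h : Le u w) :
    ∀ l : List (Equiv.Perm ℤ), (∀ x ∈ l, x ∈ bGen n) → l.prod = w →
    ∃ l' : List (Equiv.Perm ℤ), l'.Sublist l ∧ l'.prod = u := by
  induction h with
  | refl => intro l _ h; exact ⟨l, List.Sublist.refl _, h⟩
  | tail _ hbc ih =>
    intro l hl hw
    obtain ⟨p, q, hpq, hp, hq, hu, rfl⟩ := hbc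
    obtain ⟨l1, a1, a2, a3⟩ := exch l hl hpq hp hq (by
      rw [hw, Equiv.Perm.mul_apply, Equiv.Perm.mul_apply, rf_left hp hq, rf_right hp hq]; exact hu)
    rw [hw, mul_assoc, rf_mul_self hp hq, mul_one] at a3
    obtain ⟨l2, b1, b2⟩ := ih l1 (fun x hx => hl x (a1.subset hx)) a3
    exact ⟨l2, b1.trans a1, b2⟩

theorem lift {n : ℕ} {p q : ℤ} (hs : sp n p q) {u y : Equiv.Perm ℤ} (h : Le u y)
    (hy : y p < y q) : Le (u * rf p q) (y * rf p q) := by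
  obtain ⟨h1, h2, h3⟩ := sp_ne hs
  induction h using Relation.ReflTransGen.head_induction_on with
  | refl => exact Relation.ReflTransGen.refl
  | head hac hcy ih =>
    rename_i a c
    obtain ⟨x, z, hxz, hx, hz, hu, rfl⟩ := hac
    have hso := rf_odd h2 h3
    by_cases hlt : rf p q x < rf p q z
    · refine Relation.ReflTransGen.head ⟨_, _, hlt, odd_ne hso hx, odd_ne hso hz, ?_, ?_⟩ ih
      · rw [← Equiv.Perm.mul_apply, ← Equiv.Perm.mul_apply, mul_assoc, rf_mul_self h2 h3, mul_one]
        exact hu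
      · have hc := conj_rf hso hx hz
        rw [mul_assoc a, mul_assoc a]
        congr 1
        calc rf x z * rf p q = rf p q * (rf p q * rf x z) * rf p q := by
              rw [← mul_assoc, rf_mul_self h2 h3, one_mul]
          _ = _ := by rw [hc, mul_assoc, mul_assoc, rf_mul_self h2 h3, mul_one]
    · have hne : rf p q x ≠ rf p q z := fun hh => by
        have := (rf p q).injective hh; omega
      have := sp_inv hs hxz hx hz (by omega)
      rw [← this] at hcy
      exact Relation.ReflTransGen.tail hcy ⟨p, q, h1, h2, h3, hy, rfl⟩

/-- Reduced list. -/
abbrev Red (n : ℕ) (l : List (Equiv.Perm ℤ)) : Prop := IsReducedWord (bGen n) l l.prod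

theorem red_append {n : ℕ} {l : List (Equiv.Perm ℤ)} (hl : Red n l) {p q : ℤ} (hs : sp n p q)
    (h : l.prod p < l.prod q) : Red n (l ++ [rf p q]) := by
  obtain ⟨h1, h2, h3⟩ := sp_ne hs
  refine ⟨?_, rfl, ?_⟩
  · intro x hx
    rcases List.mem_append.1 hx with hx | hx
    · exact hl.1 x hx
    · exact mem_gen.2 ⟨p, q, hs, by simpa using hx⟩
  · intro l' hl' hp
    have hp' : l'.prod = l.prod * rf p q := by simpa using hp
    obtain ⟨l2, a1, a2, a3⟩ := exch l' hl' h1 h2 h3 (by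
      rw [hp', Equiv.Perm.mul_apply, Equiv.Perm.mul_apply, rf_left h2 h3, rf_right h2 h3]; exact h)
    rw [hp', mul_assoc, rf_mul_self h2 h3, mul_one] at a3
    have := hl.2.2 l2 (fun x hx => hl' x (a1.subset hx)) a3
    simp; omega

theorem red_init {n : ℕ} {l : List (Equiv.Perm ℤ)} {p q : ℤ}
    (hl : Red n (l ++ [rf p q])) (hs : sp n p q) : Red n l ∧ l.prod p < l.prod q := by
  obtain ⟨h1, h2, h3⟩ := sp_ne hs
  have hg : ∀ x ∈ l, x ∈ bGen n := fun x hx => hl.1 x (by simp [hx])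
  constructor
  · refine ⟨hg, rfl, fun l' hl' hp => ?_⟩
    have := hl.2.2 (l' ++ [rf p q]) (by
      intro x hx
      rcases List.mem_append.1 hx with hx | hx
      · exact hl' x hx
      · exact mem_gen.2 ⟨p, q, hs, by simpa using hx⟩) (by simp [hp])
    simpa using this
  · by_contra hc
    have hne : l.prod p ≠ l.prod q := fun hh => by
      have := l.prod.injective hh; omega
    obtain ⟨l2, a1, a2, a3⟩ := exch l hg h1 h2 h3 (by omega)
    have := hl.2.2 l2 (fun x hx => hg x (a1.subset hx)) (by simp [a3])
    simp at this; omega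

theorem exists_red {n : ℕ} (l : List (Equiv.Perm ℤ)) (hl : ∀ x ∈ l, x ∈ bGen n) :
    ∃ l' : List (Equiv.Perm ℤ), l'.Sublist l ∧ l'.prod = l.prod ∧ Red n l' := by
  induction l using List.reverseRecOn with
  | nil => exact ⟨[], List.Sublist.refl _, rfl, by simp, rfl, by simp⟩
  | append_singleton l s ih =>
    obtain ⟨l0, a1, a2, a3⟩ := ih (fun x hx => hl x (by simp [hx]))
    obtain ⟨p, q, hs, rfl⟩ := mem_gen.1 (hl s (by simp))
    obtain ⟨h1, h2, h3⟩ := sp_ne hs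
    by_cases h : l0.prod p < l0.prod q
    · exact ⟨l0 ++ [rf p q], a1.append (List.Sublist.refl _), by simp [a2], red_append a3 hs h⟩
    · have hne : l0.prod p ≠ l0.prod q := fun hh => by
        have := l0.prod.injective hh; omega
      obtain ⟨l2, b1, b2, b3⟩ := exch l0 a3.1 h1 h2 h3 (by omega)
      refine ⟨l2, (b1.trans a1).trans (List.sublist_append_left _ _), by simp [b3, a2],
        fun x hx => a3.1 x (b1.subset hx), rfl, fun m hm hp => ?_⟩
      have := a3.2.2 (m ++ [rf p q]) (by
        intro x hx
        rcases List.mem_append.1 hx with hx | hx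
        · exact hm x hx
        · exact mem_gen.2 ⟨p, q, hs, by simpa using hx⟩) (by
          simp [hp, b3, mul_assoc, rf_mul_self h2 h3])
      simp at this; omega

theorem sub_Le {n : ℕ} (l : List (Equiv.Perm ℤ)) (hl : Red n l) :
    ∀ l' : List (Equiv.Perm ℤ), l'.Sublist l → Le l'.prod l.prod := by
  induction l using List.reverseRecOn with
  | nil =>
    intro l' h
    rw [List.sublist_nil.1 h]; exact Relation.ReflTransGen.refl
  | append_singleton l s ih =>
    intro l' h
    obtain ⟨p, q, hs, rfl⟩ := mem_gen.1 (hl.1 s (by simp))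
    obtain ⟨h1, h2, h3⟩ := sp_ne hs
    obtain ⟨hr, ha⟩ := red_init hl hs
    obtain ⟨k1, k2, rfl, hk1, hk2⟩ := List.sublist_append_iff.1 h
    have hle := ih hr k1 hk1
    rcases List.sublist_singleton.1 hk2 with rfl | rfl
    · simp only [List.append_nil, List.prod_append, List.prod_singleton]
      exact Relation.ReflTransGen.tail hle ⟨p, q, h1, h2, h3, ha, rfl⟩
    · simp only [List.prod_append, List.prod_singleton]
      exact lift hs hle ha

theorem _root_.IsBn.mono' {m n : ℕ} (h : m ≤ n) {w : Equiv.Perm ℤ} (hw : IsBn m w) : IsBn n w :=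
  ⟨hw.1, fun i hi => hw.2 i (by have : (m : ℤ) ≤ n := by exact_mod_cast h
                                omega)⟩

theorem _root_.IsBn.mul' {n : ℕ} {u w : Equiv.Perm ℤ} (hu : IsBn n u) (hw : IsBn n w) : IsBn n (u * w) :=
  ⟨fun i => by simp [hw.1, hu.1], fun i hi => by simp [hw.2 i hi, hu.2 i hi]⟩

theorem _root_.IsBn.one' {n : ℕ} : IsBn n 1 := ⟨fun i => by simp, fun i _ => by simp⟩

theorem _root_.IsBn.inv' {n : ℕ} {u : Equiv.Perm ℤ} (hu : IsBn n u) : IsBn n u⁻¹ :=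
  ⟨fun i => by rw [Equiv.Perm.inv_eq_iff_eq, hu.1]; simp,
   fun i hi => by rw [Equiv.Perm.inv_eq_iff_eq, hu.2 i hi]⟩

theorem _root_.IsBn.zpow' {n : ℕ} {u : Equiv.Perm ℤ} (hu : IsBn n u) (k : ℤ) : IsBn n (u ^ k) := by
  let H : Subgroup (Equiv.Perm ℤ) :=
    { carrier := {x | IsBn n x}, mul_mem' := IsBn.mul', one_mem' := IsBn.one', inv_mem' := IsBn.inv' }
  exact H.zpow_mem (x := u) hu k

theorem _root_.IsBn.rf' {n : ℕ} {p q : ℤ} (hp : p ≠ 0) (hq : q ≠ 0) (hp' : |p| ≤ n) (hq' : |q| ≤ n) :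
    IsBn n (rf p q) :=
  ⟨rf_odd hp hq, fun i hi => by rw [rf_apply hp hq]; grind⟩

theorem _root_.IsBn.abs_le {n : ℕ} {u : Equiv.Perm ℤ} (hu : IsBn n u) {i : ℤ} (hi : |i| ≤ n) :
    |u i| ≤ n := by
  by_contra h
  have := u.injective (hu.2 (u i) (by omega))
  rw [this] at h; exact h hi

theorem sp_Bn {n : ℕ} (hn : 1 ≤ n) {p q : ℤ} (hs : sp n p q) : IsBn n (rf p q) := by
  obtain ⟨h1, h2, h3⟩ := sp_ne hs
  have hn' : (1 : ℤ) ≤ n := by exact_mod_cast hn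
  unfold sp at hs
  exact IsBn.rf' h2 h3 (by grind) (by grind)

theorem gen_Bn {n : ℕ} (hn : 1 ≤ n) (l : List (Equiv.Perm ℤ)) (hl : ∀ x ∈ l, x ∈ bGen n) :
    IsBn n l.prod := by
  induction l with
  | nil => exact IsBn.one'
  | cons a l ih =>
    obtain ⟨p, q, h, rfl⟩ := mem_gen.1 (hl a (by simp))
    rw [List.prod_cons]
    exact (sp_Bn hn h).mul' (ih (fun x hx => hl x (by simp [hx])))

theorem clo_conj {n : ℕ} {y : Equiv.Perm ℤ} (hy : y ∈ Submonoid.closure (bGen n))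
    (ho : ∀ i, y (-i) = - y i) (hyy : y * y = 1) {p q : ℤ} (hp : p ≠ 0) (hq : q ≠ 0)
    (h : rf p q ∈ Submonoid.closure (bGen n)) :
    rf (y p) (y q) ∈ Submonoid.closure (bGen n) := by
  have : rf (y p) (y q) = y * rf p q * y := by
    rw [conj_rf ho hp hq, mul_assoc, hyy, mul_one]
  rw [this]
  exact mul_mem (mul_mem hy h) hy

theorem clo_sp {n : ℕ} {p q : ℤ} (h : sp n p q) : rf p q ∈ Submonoid.closure (bGen n) :=
  Submonoid.subset_closure (mem_gen.2 ⟨p, q, h, rfl⟩)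

theorem clo_pos {n : ℕ} (k : ℕ) (p : ℤ) (hp : 1 ≤ p) (h : p + k ≤ n) :
    rf p (p + k) ∈ Submonoid.closure (bGen n) := by
  induction k with
  | zero => simp [rf_self (show p ≠ 0 by omega)]
  | succ k ih =>
    push_cast at h ⊢
    by_cases hk : k = 0
    · subst hk; exact clo_sp (Or.inr ⟨hp, by simp, by simpa using h⟩)
    have hs : sp n (p + k) (p + k + 1) := Or.inr ⟨by omega, rfl, by omega⟩
    obtain ⟨h1, h2, h3⟩ := sp_ne hs
    have := clo_conj (clo_sp hs) (rf_odd h2 h3) (rf_mul_self h2 h3) (show p ≠ 0 by omega) h2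
      (ih (by omega))
    rw [rf_left h2 h3] at this
    have e : rf (p + k) (p + k + 1) p = p := by rw [rf_apply h2 h3]; grind
    rwa [e, add_assoc] at this

theorem clo_neg {n : ℕ} (k : ℕ) (h : (1 : ℤ) + k ≤ n) :
    rf (-(1 + k)) (1 + k) ∈ Submonoid.closure (bGen n) := by
  induction k with
  | zero => exact clo_sp (Or.inl (by simp))
  | succ k ih =>
    push_cast at h ⊢
    have hs : sp n (1 + k) (1 + k + 1) := Or.inr ⟨by omega, rfl, by omega⟩
    obtain ⟨h1, h2, h3⟩ := sp_ne hs
    have := clo_conj (clo_sp hs) (rf_odd h2 h3) (rf_mul_self h2 h3) (show (-(1 + k : ℤ)) ≠ 0 by omega)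
      h2 (ih (by omega))
    rw [rf_odd h2 h3, rf_left h2 h3] at this
    rwa [add_assoc] at this

theorem clo_all {n : ℕ} {p q : ℤ} (hp : p ≠ 0) (hpq : |p| ≤ q) (hq : q ≤ n) :
    rf p q ∈ Submonoid.closure (bGen n) := by
  have hP : ∀ p : ℤ, 1 ≤ p → p ≤ q → rf p q ∈ Submonoid.closure (bGen n) := by
    intro p h1 h2
    have := clo_pos (n := n) (q - p).toNat p h1 (by omega)
    rwa [show p + ((q - p).toNat : ℤ) = q by omega] at this
  have hN : ∀ p : ℤ, 1 ≤ p → p ≤ n → rf (-p) p ∈ Submonoid.closure (bGen n) := by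
    intro p h1 h2
    have := clo_neg (n := n) (p - 1).toNat (by omega)
    rwa [show 1 + ((p - 1).toNat : ℤ) = p by omega] at this
  have := abs_le.1 hpq
  rcases lt_or_gt_of_ne hp with h | h
  · by_cases e : p = -q
    · subst e; exact hN q (by omega) hq
    · have h2 : -p ≠ 0 := by omega
      have a := hN (-p) (by omega) (by omega)
      rw [neg_neg] at a
      have := clo_conj a (rf_odd hp h2) (rf_mul_self hp h2) h2 (show q ≠ 0 by omega)
        (hP (-p) (by omega) (by omega))
      rw [rf_right hp h2] at this
      have e : rf p (-p) q = q := by rw [rf_apply hp h2]; grind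
      rwa [e] at this
  · exact hP p (by omega) (by omega)

theorem Bn_clo {n : ℕ} (m : ℕ) (hm : m ≤ n) (w : Equiv.Perm ℤ) (hw : IsBn m w) :
    w ∈ Submonoid.closure (bGen n) := by
  induction m generalizing w with
  | zero =>
    have : w = 1 := by
      ext i
      by_cases h : i = 0
      · subst h; have := hw.1 0; simp at this ⊢; omega
      · simpa using hw.2 i (by simpa using h)
    rw [this]; exact one_mem _
  | succ m ih =>
    have hi := hw.inv'
    have hM : ((m : ℤ) + 1) ≠ 0 := by omega
    set p := w⁻¹ ((m : ℤ) + 1) with hp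
    have hwp : w p = m + 1 := by simp [hp]
    have hp0 : p ≠ 0 := odd_ne hi.1 hM
    have hpa : |p| ≤ (m : ℤ) + 1 := by
      have := hi.abs_le (i := (m : ℤ) + 1) (by push_cast; rw [abs_of_nonneg] <;> omega)
      push_cast at this; exact this
    have h1 : IsBn (m + 1) (w * rf p (m + 1)) :=
      hw.mul' (IsBn.rf' hp0 hM (by push_cast; exact hpa) (by push_cast; rw [abs_of_nonneg] <;> omega))
    have hfix : (w * rf p (m + 1)) (m + 1) = m + 1 := by
      rw [Equiv.Perm.mul_apply, rf_right hp0 hM, hwp]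
    have h2 : IsBn m (w * rf p (m + 1)) := by
      refine ⟨h1.1, fun i hi => ?_⟩
      by_cases h : (m : ℤ) + 1 < |i|
      · exact h1.2 i (by push_cast; exact h)
      · have : i = m + 1 ∨ i = -(m + 1) := by grind
        rcases this with rfl | rfl
        · exact hfix
        · rw [h1.1, hfix]
    have h3 := ih (by omega) _ h2
    have : w = (w * rf p (m + 1)) * rf p (m + 1) := by
      rw [mul_assoc, rf_mul_self hp0 hM, mul_one]
    rw [this]
    exact mul_mem h3 (clo_all hp0 hpa (by exact_mod_cast hm))

theorem exists_red_Bn {n : ℕ} {w : Equiv.Perm ℤ} (hw : IsBn n w) :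
    ∃ l : List (Equiv.Perm ℤ), Red n l ∧ l.prod = w := by
  obtain ⟨l, h1, h2⟩ := Submonoid.exists_list_of_mem_closure (Bn_clo n le_rfl w hw)
  obtain ⟨l', _, h4, h5⟩ := exists_red l h1
  exact ⟨l', h5, h4.trans h2⟩

theorem bruhat_iff {n : ℕ} (hn : 1 ≤ n) {u w : Equiv.Perm ℤ} (hw : IsBn n w) :
    (IsBn n u ∧ BruhatLe (bGen n) u w) ↔ Le u w := by
  constructor
  · rintro ⟨_, lw, lv, h1, h2, h3⟩
    have := sub_Le lw ⟨h1.1, rfl, by rw [h1.2.1]; exact h1.2.2⟩ lv h3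
    rwa [h1.2.1, h2.2.1] at this
  · intro h
    obtain ⟨l, hl, rfl⟩ := exists_red_Bn hw
    obtain ⟨l', h1, rfl⟩ := Le_sub h l hl.1 rfl
    have hg : ∀ x ∈ l', x ∈ bGen n := fun x hx => hl.1 x (h1.subset hx)
    obtain ⟨l2, a1, a2, a3⟩ := exists_red l' hg
    refine ⟨gen_Bn hn l' hg, l, l2, hl, ?_, a1.trans h1⟩
    rw [← a2]; exact a3

theorem F1 {n : ℕ} {w : Equiv.Perm ℤ} (hw : IsBn n w) {p q : ℤ} (hs : sp n p q)
    (h : w p < w q) (u : Equiv.Perm ℤ) :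
    Le u (w * rf p q) ↔ Le u w ∨ Le (u * rf p q) w := by
  obtain ⟨h1, h2, h3⟩ := sp_ne hs
  constructor
  · intro hu
    obtain ⟨l, hl, rfl⟩ := exists_red_Bn hw
    obtain ⟨l', hl', rfl⟩ := Le_sub (n := n) hu (l ++ [rf p q]) (red_append hl hs h).1 (by simp)
    obtain ⟨k1, k2, rfl, hk1, hk2⟩ := List.sublist_append_iff.1 hl'
    have hle := sub_Le l hl k1 hk1
    rcases List.sublist_singleton.1 hk2 with rfl | rfl
    · left; simpa using hle
    · right; simpa [mul_assoc, rf_mul_self h2 h3] using hle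
  · rintro (hu | hu)
    · exact Relation.ReflTransGen.tail hu ⟨p, q, h1, h2, h3, h, rfl⟩
    · have := lift hs hu h
      rwa [mul_assoc, rf_mul_self h2 h3, mul_one] at this

theorem F2 {n : ℕ} (hn : 1 ≤ n) {w : Equiv.Perm ℤ} (hw : IsBn n w) {p q : ℤ} (hs : sp n p q)
    (h : w q < w p) (u : Equiv.Perm ℤ) (hu : Le u w) : Le (u * rf p q) w := by
  obtain ⟨h1, h2, h3⟩ := sp_ne hs
  have hW := hw.mul' (sp_Bn hn hs)
  have e : w * rf p q * rf p q = w := by rw [mul_assoc, rf_mul_self h2 h3, mul_one]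
  have := F1 hW hs (by
    rw [Equiv.Perm.mul_apply, Equiv.Perm.mul_apply, rf_left h2 h3, rf_right h2 h3]; exact h)
  rw [e] at this
  rw [this] at hu ⊢
  rw [mul_assoc, rf_mul_self h2 h3, mul_one]
  exact hu.symm

theorem Bn_ext {n : ℕ} {u w : Equiv.Perm ℤ} (hu : IsBn n u) (hw : IsBn n w)
    (h : ∀ i : ℤ, 1 ≤ i → i ≤ n → u i = w i) : u = w := by
  ext i
  by_cases hi : (n : ℤ) < |i|
  · rw [hu.2 i hi, hw.2 i hi]
  · rcases lt_trichotomy i 0 with h0 | h0 | h0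
    · have := h (-i) (by omega) (by grind)
      rw [hu.1, hw.1] at this; omega
    · have h1 := hu.1 0
      have h2 := hw.1 0
      subst h0; simp at h1 h2; omega
    · exact h i (by omega) (by grind)

theorem Bn_down {m : ℕ} {w : Equiv.Perm ℤ} (hw : IsBn (m + 1) w) (h : w (m + 1) = m + 1) :
    IsBn m w := by
  refine ⟨hw.1, fun i hi => ?_⟩
  by_cases h' : (m : ℤ) + 1 < |i|
  · exact hw.2 i (by push_cast; exact h')
  · have : i = m + 1 ∨ i = -(m + 1) := by grind
    rcases this with rfl | rfl
    · exact h
    · rw [hw.1, h]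

theorem Le_Bn {m : ℕ} {u w : Equiv.Perm ℤ} (h : Le u w) (hw : IsBn m w) : IsBn m u := by
  induction h using Relation.ReflTransGen.head_induction_on with
  | refl => exact hw
  | head hac hcw ih =>
    clear hcw
    rename_i a c
    obtain ⟨p, q, hpq, hp, hq, hu, rfl⟩ := hac
    have e : a = a * rf p q * rf p q := by rw [mul_assoc, rf_mul_self hp hq, mul_one]
    rw [e]
    have hlt : (a * rf p q) q < (a * rf p q) p := by
      rw [Equiv.Perm.mul_apply, Equiv.Perm.mul_apply, rf_left hp hq, rf_right hp hq]; exact hu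
    generalize a * rf p q = c at *
    refine ih.mul' ?_
    have hq1 : q ≤ m := by
      by_contra hc
      have h1 := ih.2 q (by grind)
      by_cases hpm : |p| ≤ m
      · have := ih.abs_le hpm; grind
      · have := ih.2 p (by omega); omega
    have hp1 : -(m : ℤ) ≤ p := by
      by_contra hc
      have h1 := ih.2 p (by grind)
      by_cases hqm : |q| ≤ m
      · have := ih.abs_le hqm; grind
      · have := ih.2 q (by omega); omega
    exact IsBn.rf' hp hq (by grind) (by grind)

theorem Le_inv {u w : Equiv.Perm ℤ} {n : ℕ} (h : Le u w) (hw : IsBn n w) : Le u⁻¹ w⁻¹ := by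
  induction h using Relation.ReflTransGen.head_induction_on with
  | refl => exact Relation.ReflTransGen.refl
  | head hac hc ih =>
    rename_i a c
    have hcB := Le_Bn hc hw
    have haB : IsBn n a := Le_Bn (Relation.ReflTransGen.head hac hc) hw
    obtain ⟨p, q, hpq, hp, hq, hu, rfl⟩ := hac
    refine Relation.ReflTransGen.head ⟨a p, a q, hu, odd_ne haB.1 hp, odd_ne haB.1 hq, ?_, ?_⟩ ih
    · simpa using hpq
    · rw [mul_inv_rev, rf_inv hp hq]
      have := conj_rf haB.1 hp hq
      rw [eq_inv_mul_iff_mul_eq, ← mul_assoc, this, mul_assoc, mul_inv_cancel, mul_one]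

/-- `W` is `w'` with the letter `m+1` inserted at position `d`. -/
def Ins (m : ℕ) (d : ℤ) (w' W : Equiv.Perm ℤ) : Prop :=
  (∀ i : ℤ, 1 ≤ i → i < d → W i = w' i) ∧ W d = m + 1 ∧
    ∀ i : ℤ, d < i → i ≤ m + 1 → W i = w' (i - 1)

theorem Ins_step {m : ℕ} {d : ℤ} {w' W : Equiv.Perm ℤ} (hd : 1 ≤ d) (hdm : d ≤ m)
    (h : Ins m d w' W) : Ins m (d + 1) w' (W * rf d (d + 1)) := by
  obtain ⟨h1, h2, h3⟩ := h
  have a : d ≠ 0 := by omega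
  have b : d + 1 ≠ 0 := by omega
  refine ⟨fun i hi hi' => ?_, ?_, fun i hi hi' => ?_⟩
  · rw [Equiv.Perm.mul_apply, rf_apply a b]
    by_cases e : i = d
    · subst e; rw [if_pos rfl, h3 _ (by omega) (by omega)]; simp
    · rw [← h1 i hi (by omega)]; congr 1; grind
  · rw [Equiv.Perm.mul_apply, rf_right a b, h2]
  · rw [Equiv.Perm.mul_apply, rf_apply a b, ← h3 i (by omega) hi']; congr 1; grind

theorem Ins_step' {m : ℕ} {d : ℤ} {w' W : Equiv.Perm ℤ} (hd : 1 ≤ d) (hdm : d ≤ m)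
    (h : Ins m (d + 1) w' W) : Ins m d w' (W * rf d (d + 1)) := by
  obtain ⟨h1, h2, h3⟩ := h
  have a : d ≠ 0 := by omega
  have b : d + 1 ≠ 0 := by omega
  refine ⟨fun i hi hi' => ?_, ?_, fun i hi hi' => ?_⟩
  · rw [Equiv.Perm.mul_apply, rf_apply a b, ← h1 i hi (by omega)]; congr 1; grind
  · rw [Equiv.Perm.mul_apply, rf_left a b, h2]
  · rw [Equiv.Perm.mul_apply, rf_apply a b]
    by_cases e : i = d + 1
    · subst e; rw [if_neg (by omega), if_pos rfl, h1 _ hd (by omega)]; simp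
    · rw [← h3 i (by omega) hi']; congr 1; grind

theorem sd_Bn {m : ℕ} {d : ℤ} (hd : 1 ≤ d) (hdm : d ≤ m) : IsBn (m + 1) (rf d (d + 1)) :=
  IsBn.rf' (by omega) (by omega) (by push_cast; grind) (by push_cast; grind)

theorem Ins_exists {m : ℕ} {w' : Equiv.Perm ℤ} (hw : IsBn m w') (k : ℕ) (hk : k ≤ m) :
    ∃ W, IsBn (m + 1) W ∧ Ins m (m + 1 - k) w' W := by
  induction k with
  | zero =>
    refine ⟨w', hw.mono' (by omega), fun _ _ _ => rfl, ?_, fun i hi hi' => by omega⟩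
    simpa using hw.2 (m + 1) (by grind)
  | succ k ih =>
    obtain ⟨W, h1, h2⟩ := ih (by omega)
    have e : (m : ℤ) + 1 - k = (m + 1 - (k + 1 : ℕ)) + 1 := by push_cast; ring
    rw [e] at h2
    have a : (1 : ℤ) ≤ m + 1 - (k + 1 : ℕ) := by push_cast; omega
    have b : (m : ℤ) + 1 - (k + 1 : ℕ) ≤ m := by push_cast; omega
    exact ⟨_, h1.mul' (sd_Bn a b), Ins_step' a b h2⟩

theorem Del_exists {m : ℕ} (k : ℕ) (hk : k ≤ m) (W : Equiv.Perm ℤ) (hW : IsBn (m + 1) W)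
    (h : W (m + 1 - k) = m + 1) : ∃ w', IsBn m w' ∧ Ins m (m + 1 - k) w' W := by
  induction k generalizing W with
  | zero =>
    simp at h
    exact ⟨W, Bn_down hW h, fun _ _ _ => rfl, by simpa using h, fun i hi hi' => by omega⟩
  | succ k ih =>
    have e : (m : ℤ) + 1 - k = (m + 1 - (k + 1 : ℕ)) + 1 := by push_cast; ring
    have a : (1 : ℤ) ≤ m + 1 - (k + 1 : ℕ) := by push_cast; omega
    have b : (m : ℤ) + 1 - (k + 1 : ℕ) ≤ m := by push_cast; omega
    rw [e] at ih
    generalize (m : ℤ) + 1 - (k + 1 : ℕ) = d at *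
    obtain ⟨w', h1, h2⟩ := ih (by omega) _ (hW.mul' (sd_Bn a b)) (by
      rw [Equiv.Perm.mul_apply, rf_right (by omega) (by omega), h])
    have := Ins_step' a b h2
    rw [mul_assoc, rf_mul_self (by omega) (by omega), mul_one] at this
    exact ⟨w', h1, this⟩

/-- Strictly decreasing on `[d, m]`. -/
def Dec (m : ℕ) (d : ℤ) (w : Equiv.Perm ℤ) : Prop := ∀ i j : ℤ, d ≤ i → i < j → j ≤ m → w j < w i

theorem keyK {n m : ℕ} (hmn : m + 1 ≤ n) {w' : Equiv.Perm ℤ} (hw : IsBn m w') (k : ℕ) (hk : k ≤ m) :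
    ∀ W : Equiv.Perm ℤ, IsBn (m + 1) W → Ins m (m + 1 - k) w' W → Dec m (m + 1 - k) w' →
    ∀ u, Le u W ↔ ∃ i : ℤ, (m + 1 - k : ℤ) ≤ i ∧ i ≤ m + 1 ∧
      ∃ u', Le u' w' ∧ u = u' * rf i (m + 1) := by
  have hM : (m : ℤ) + 1 ≠ 0 := by omega
  induction k with
  | zero =>
    intro W hW hI _ u
    have : W = w' := Bn_ext hW (hw.mono' (by omega)) (fun i h1 h2 => by
      push_cast at h2
      by_cases e : i = m + 1
      · subst e
        rw [hw.2 _ (by grind)]; simpa using hI.2.1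
      · exact hI.1 i h1 (by simp; omega))
    subst this
    constructor
    · intro h; exact ⟨m + 1, by simp, le_rfl, u, h, by rw [rf_self hM, mul_one]⟩
    · rintro ⟨i, h1, h2, u', h3, rfl⟩
      have : i = m + 1 := by simp at h1; omega
      rw [this, rf_self hM, mul_one]; exact h3
  | succ k ih =>
    intro W hW hI hD u
    have e : (m : ℤ) + 1 - k = (m + 1 - (k + 1 : ℕ)) + 1 := by push_cast; ring
    have a : (1 : ℤ) ≤ m + 1 - (k + 1 : ℕ) := by push_cast; omega
    have b : (m : ℤ) + 1 - (k + 1 : ℕ) ≤ m := by push_cast; omega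
    rw [e] at ih
    generalize (m : ℤ) + 1 - (k + 1 : ℕ) = d at *
    have a0 : d ≠ 0 := by omega
    have b0 : d + 1 ≠ 0 := by omega
    have hs : sp n d (d + 1) := Or.inr ⟨a, rfl, by omega⟩
    have hI1 := Ins_step a b hI
    have hB1 := hW.mul' (sd_Bn a b)
    have IH := ih (by omega) _ hB1 hI1 (fun i j h1 h2 h3 => hD i j (by omega) h2 h3)
    have ess : ∀ x : Equiv.Perm ℤ, x * rf d (d + 1) * rf d (d + 1) = x := fun x => by
      rw [mul_assoc, rf_mul_self a0 b0, mul_one]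
    have hF := F1 (hB1.mono' hmn) hs (by
      rw [hI1.1 d a (by omega), hI1.2.1]
      have := hw.abs_le (i := d) (by grind)
      grind) u
    rw [ess] at hF
    rw [hF, IH, IH]
    by_cases hdm : d = m
    · subst hdm
      constructor
      · rintro (⟨i, h1, h2, u', h3, rfl⟩ | ⟨i, h1, h2, u', h3, h4⟩)
        · exact ⟨i, by omega, h2, u', h3, rfl⟩
        · have : i = m + 1 := by omega
          rw [this, rf_self hM, mul_one] at h4
          exact ⟨m, le_rfl, by omega, u', h3, by rw [← h4, ess]⟩
      · rintro ⟨i, h1, h2, u', h3, rfl⟩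
        by_cases hi : i = m
        · right
          exact ⟨m + 1, le_rfl, le_rfl, u', h3, by rw [hi, ess, rf_self hM, mul_one]⟩
        · left; exact ⟨i, by omega, h2, u', h3, rfl⟩
    · have hF2 : ∀ x, Le x w' → Le (x * rf d (d + 1)) w' :=
        F2 (by omega) (hw.mono' (by omega)) hs (hD _ _ le_rfl (by omega) (by omega))
      have hc : ∀ i : ℤ, i ≠ 0 → rf d (d + 1) * rf i (m + 1)
          = rf (rf d (d + 1) i) (m + 1) * rf d (d + 1) := by
        intro i hi
        have := conj_rf (rf_odd a0 b0) hi hM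
        rwa [show rf d (d + 1) (m + 1) = m + 1 by rw [rf_apply a0 b0]; grind] at this
      constructor
      · rintro (⟨i, h1, h2, u', h3, rfl⟩ | ⟨i, h1, h2, u', h3, h4⟩)
        · exact ⟨i, by omega, h2, u', h3, rfl⟩
        · have hr : d ≤ rf d (d + 1) i ∧ rf d (d + 1) i ≤ m + 1 := by
            rw [rf_apply a0 b0]; grind
          refine ⟨rf d (d + 1) i, hr.1, hr.2, u' * rf d (d + 1), hF2 _ h3, ?_⟩
          rw [mul_assoc, hc _ (by omega), ← ess u, h4, ← Equiv.Perm.mul_apply, rf_mul_self a0 b0,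
            mul_assoc]
          rfl
      · rintro ⟨i, h1, h2, u', h3, rfl⟩
        by_cases hi : i = d
        · right
          refine ⟨d + 1, le_rfl, by omega, u' * rf d (d + 1), hF2 _ h3, ?_⟩
          subst hi
          rw [mul_assoc, mul_assoc u' (rf i (i + 1)), hc _ b0, rf_right a0 b0]
        · left; exact ⟨i, by omega, h2, u', h3, rfl⟩

theorem piv (u : Equiv.Perm ℤ) (x : ℤ) : u⁻¹ (u x) = x := by simp

theorem pvi (u : Equiv.Perm ℤ) (x : ℤ) : u (u⁻¹ x) = x := by simp

theorem Ins_exists_d {m : ℕ} {w' : Equiv.Perm ℤ} (hw : IsBn m w') {d : ℤ} (h1 : 1 ≤ d)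
    (h2 : d ≤ m + 1) : ∃ W, IsBn (m + 1) W ∧ Ins m d w' W := by
  have e : (m : ℤ) + 1 - ((m + 1 - d).toNat : ℕ) = d := by omega
  have := Ins_exists hw (m + 1 - d).toNat (by omega)
  rwa [e] at this

theorem Del_exists_d {m : ℕ} {W : Equiv.Perm ℤ} (hW : IsBn (m + 1) W) {d : ℤ} (h1 : 1 ≤ d)
    (h2 : d ≤ m + 1) (h : W d = m + 1) : ∃ w', IsBn m w' ∧ Ins m d w' W := by
  have e : (m : ℤ) + 1 - ((m + 1 - d).toNat : ℕ) = d := by omega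
  have := Del_exists (m + 1 - d).toNat (by omega) W hW (by rwa [e])
  rwa [e] at this

theorem keyK_d {n m : ℕ} (hmn : m + 1 ≤ n) {w' W : Equiv.Perm ℤ} (hw : IsBn m w')
    (hW : IsBn (m + 1) W) {d : ℤ} (h1 : 1 ≤ d) (h2 : d ≤ m + 1) (hI : Ins m d w' W)
    (hD : Dec m d w') (u : Equiv.Perm ℤ) :
    Le u W ↔ ∃ i : ℤ, d ≤ i ∧ i ≤ m + 1 ∧ ∃ u', Le u' w' ∧ u = u' * rf i (m + 1) := by
  have e : (m : ℤ) + 1 - ((m + 1 - d).toNat : ℕ) = d := by omega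
  have := keyK hmn hw (m + 1 - d).toNat (by omega) W hW (by rwa [e]) (by rwa [e]) u
  rwa [e] at this

/-- Conjugacy by an element preserving cycles. -/
def Cj (m : ℕ) (u u' : Equiv.Perm ℤ) : Prop :=
  ∃ y, IsBn m y ∧ y * u = u' * y ∧ ∀ z, Equiv.Perm.SameCycle u z (y z)

theorem Cj_refl (m : ℕ) (u : Equiv.Perm ℤ) : Cj m u u :=
  ⟨1, IsBn.one', by simp, fun z => by simpa using Equiv.Perm.SameCycle.refl _ _⟩

theorem sc_step {u U : Equiv.Perm ℤ} (h : ∀ a, Equiv.Perm.SameCycle U a (u a)) {a b : ℤ}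
    (hab : Equiv.Perm.SameCycle u a b) : Equiv.Perm.SameCycle U a b := by
  obtain ⟨k, rfl⟩ := hab
  induction k using Int.induction_on with
  | zero => simpa using Equiv.Perm.SameCycle.refl _ _
  | succ i ih =>
    refine ih.trans ?_
    rw [add_comm, zpow_add, zpow_one]; exact h _
  | pred i ih =>
    refine ih.trans ?_
    have := h ((u ^ (-(i : ℤ) - 1)) a)
    rw [← Equiv.Perm.mul_apply, ← zpow_one_add] at this
    rw [show (1 : ℤ) + (-(i : ℤ) - 1) = -i by ring] at this
    exact this.symm

theorem sc_one {U : Equiv.Perm ℤ} {a b : ℤ} (h : U a = b) : Equiv.Perm.SameCycle U a b :=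
  ⟨1, by simpa using h⟩

theorem sc_two {U : Equiv.Perm ℤ} {a b : ℤ} (h : U (U a) = b) : Equiv.Perm.SameCycle U a b :=
  (sc_one rfl).trans (sc_one h)

theorem sc_right {m : ℕ} {u : Equiv.Perm ℤ} (hu : IsBn m u) {i : ℤ} (hi : 1 ≤ i)
    (a : ℤ) : Equiv.Perm.SameCycle (u * rf i (m + 1)) a (u a) := by
  have i0 : i ≠ 0 := by omega
  have M0 : (m : ℤ) + 1 ≠ 0 := by omega
  have hM := hu.2 (m + 1) (by grind)
  have hM' : u (-(m + 1)) = -(m + 1) := by rw [hu.1, hM]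
  by_cases h1 : a = i
  · subst h1
    apply sc_two
    rw [Equiv.Perm.mul_apply, Equiv.Perm.mul_apply, rf_left i0 M0, hM, rf_right i0 M0]
  by_cases h2 : a = -i
  · subst h2
    apply sc_two
    rw [Equiv.Perm.mul_apply, Equiv.Perm.mul_apply, rf_odd i0 M0, rf_left i0 M0, hM',
      rf_odd i0 M0, rf_right i0 M0]
  by_cases h3 : a = m + 1
  · subst h3; rw [hM]
  by_cases h4 : a = -(m + 1)
  · subst h4; rw [hM']
  apply sc_one
  rw [Equiv.Perm.mul_apply, rf_apply i0 M0, if_neg h1, if_neg h3, if_neg h2, if_neg h4]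

theorem sc_left {m : ℕ} {u : Equiv.Perm ℤ} (hu : IsBn m u) {i : ℤ} (hi : 1 ≤ i)
    (a : ℤ) : Equiv.Perm.SameCycle (rf i (m + 1) * u) a (u a) := by
  have i0 : i ≠ 0 := by omega
  have M0 : (m : ℤ) + 1 ≠ 0 := by omega
  have hM := hu.2 (m + 1) (by grind)
  have hM' : u (-(m + 1)) = -(m + 1) := by rw [hu.1, hM]
  by_cases h1 : u a = i
  · apply sc_two
    rw [Equiv.Perm.mul_apply, Equiv.Perm.mul_apply, h1, rf_left i0 M0, hM, rf_right i0 M0]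
  by_cases h2 : u a = -i
  · apply sc_two
    rw [Equiv.Perm.mul_apply, Equiv.Perm.mul_apply, h2, rf_odd i0 M0, rf_left i0 M0, hM',
      rf_odd i0 M0, rf_right i0 M0]
  by_cases h3 : u a = m + 1
  · have : a = m + 1 := u.injective (h3.trans hM.symm)
    subst this; rw [hM]
  by_cases h4 : u a = -(m + 1)
  · have : a = -(m + 1) := u.injective (h4.trans hM'.symm)
    subst this; rw [hM']
  apply sc_one
  rw [Equiv.Perm.mul_apply, rf_apply i0 M0, if_neg h1, if_neg h3, if_neg h2, if_neg h4]

theorem Cj_trans {m : ℕ} {a b c : Equiv.Perm ℤ} (h1 : Cj m a b) (h2 : Cj m b c) : Cj m a c := by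
  obtain ⟨y, y1, y2, y3⟩ := h1
  obtain ⟨z, z1, z2, z3⟩ := h2
  refine ⟨z * y, z1.mul' y1, by rw [mul_assoc, y2, ← mul_assoc, z2, mul_assoc], fun t => ?_⟩
  have hb : b = y * a * y⁻¹ := by rw [y2, mul_assoc, mul_inv_cancel, mul_one]
  have := z3 (y t)
  rw [hb, Equiv.Perm.sameCycle_conj] at this
  simp only [piv] at this
  have h4 := y3 (y⁻¹ (z (y t)))
  simp only [pvi] at h4
  exact this.trans h4

theorem Cj_E2 {m : ℕ} {u : Equiv.Perm ℤ} (hu : IsBn m u) {i : ℤ} (hi : 1 ≤ i) :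
    Cj (m + 1) (rf i (m + 1) * u) (u * rf i (m + 1)) :=
  ⟨u, hu.mono' (by omega), by rw [mul_assoc], sc_left hu hi⟩

theorem Cj_E1 {m : ℕ} {u u' : Equiv.Perm ℤ} (h : Cj m u u') (hu : IsBn m u)
    {i : ℤ} (hi : 1 ≤ i) : Cj (m + 1) (u * rf i (m + 1)) (u' * rf i (m + 1)) := by
  have i0 : i ≠ 0 := by omega
  have M0 : (m : ℤ) + 1 ≠ 0 := by omega
  obtain ⟨y, y1, y2, y3⟩ := h
  obtain ⟨k, hk⟩ := y3 (y⁻¹ i)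
  simp only [pvi] at hk
  have hB : IsBn m (y * u ^ (-k)) := y1.mul' (hu.zpow' _)
  have hzi : (y * u ^ (-k)) i = i := by
    rw [Equiv.Perm.mul_apply]
    have : (u ^ (-k)) i = y⁻¹ i := by rw [zpow_neg, Equiv.Perm.inv_eq_iff_eq]; exact hk.symm
    rw [this]; simp
  have hzM := hB.2 (m + 1) (by grind)
  have hc := conj_rf hB.1 i0 M0
  rw [hzi, hzM] at hc
  have hzu : (y * u ^ (-k)) * u = u' * (y * u ^ (-k)) := by
    rw [← mul_assoc, ← y2, mul_assoc, mul_assoc]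
    congr 1
    exact ((Commute.refl u).zpow_left _).eq
  refine ⟨y * u ^ (-k), hB.mono' (by omega), ?_, fun z => ?_⟩
  · rw [← mul_assoc, hzu, mul_assoc, hc, mul_assoc]
  · refine sc_step (sc_right hu hi) ?_
    have : Equiv.Perm.SameCycle u z ((u ^ (-k)) z) := ⟨-k, rfl⟩
    exact this.trans (y3 _)

theorem inv3412 {n : ℕ} {w : Equiv.Perm ℤ} (hw : IsBn n w) (h : LongAvoids3412 n w) :
    LongAvoids3412 n w⁻¹ := by
  rintro ⟨i1, i2, i3, i4, a1, a2, a3, a4, a5, b1, b2, b3, b4, c1, c2, c3⟩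
  have hb := hw.inv'
  have d3 := hb.abs_le (i := i3) (by grind)
  have d2 := hb.abs_le (i := i2) (by grind)
  refine h ⟨w⁻¹ i3, w⁻¹ i4, w⁻¹ i1, w⁻¹ i2, by grind, c1, c2, c3, by grind,
    odd_ne hb.1 b3, odd_ne hb.1 b4, odd_ne hb.1 b1, odd_ne hb.1 b2, ?_⟩
  simp only [pvi]
  omega

theorem inv4231 {n : ℕ} {w : Equiv.Perm ℤ} (hw : IsBn n w) (h : LongAvoids4231 n w) :
    LongAvoids4231 n w⁻¹ := by
  rintro ⟨i1, i2, i3, i4, a1, a2, a3, a4, a5, b1, b2, b3, b4, c1, c2, c3⟩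
  have hb := hw.inv'
  have d4 := hb.abs_le (i := i4) (by grind)
  have d1 := hb.abs_le (i := i1) (by grind)
  refine h ⟨w⁻¹ i4, w⁻¹ i2, w⁻¹ i3, w⁻¹ i1, by grind, c1, c2, c3, by grind,
    odd_ne hb.1 b4, odd_ne hb.1 b2, odd_ne hb.1 b3, odd_ne hb.1 b1, ?_⟩
  simp only [pvi]
  omega

/-- position embedding -/
def io (d k : ℤ) : ℤ := if |k| < d then k else if 0 < k then k + 1 else k - 1

theorem io_W {m : ℕ} {d : ℤ} {w' W : Equiv.Perm ℤ} (hw : IsBn m w') (hW : IsBn (m + 1) W)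
    (hI : Ins m d w' W) {k : ℤ} (h0 : k ≠ 0) (h1 : -(m : ℤ) ≤ k) (h2 : k ≤ m) :
    W (io d k) = w' k := by
  unfold io
  have key : ∀ k : ℤ, 1 ≤ k → k ≤ m → W (if k < d then k else k + 1) = w' k := by
    intro k h1 h2
    split_ifs with h
    · exact hI.1 k h1 h
    · rw [hI.2.2 (k + 1) (by omega) (by omega)]; simp
  rcases lt_or_gt_of_ne h0 with h | h
  · have := key (-k) (by omega) (by omega)
    rw [hw.1] at this
    rw [abs_of_neg h, if_neg (show ¬ 0 < k by omega), ← neg_neg (w' k), ← this, ← hW.1]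
    congr 1; split_ifs <;> omega
  · have := key k (by omega) (by omega)
    rw [abs_of_pos h, if_pos h]; exact this

theorem io_mono {d i j : ℤ} (hi : i ≠ 0) (hj : j ≠ 0) (h : i < j) : io d i < io d j := by
  unfold io; grind

theorem io_ne {d i : ℤ} (hi : i ≠ 0) : io d i ≠ 0 := by
  unfold io; grind

theorem io_rng {m : ℕ} {d i : ℤ} (h1 : -(m : ℤ) ≤ i) (h2 : i ≤ m) :
    -((m + 1 : ℕ) : ℤ) ≤ io d i ∧ io d i ≤ (m + 1 : ℕ) := by
  unfold io; push_cast; grind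

theorem del3412 {m : ℕ} {d : ℤ} {w' W : Equiv.Perm ℤ} (hw : IsBn m w') (hW : IsBn (m + 1) W)
    (hI : Ins m d w' W) (h : LongAvoids3412 (m + 1) W) : LongAvoids3412 m w' := by
  rintro ⟨i1, i2, i3, i4, a1, a2, a3, a4, a5, b1, b2, b3, b4, c1, c2, c3⟩
  refine h ⟨io d i1, io d i2, io d i3, io d i4, (io_rng a1 (by omega)).1, io_mono b1 b2 a2,
    io_mono b2 b3 a3, io_mono b3 b4 a4, (io_rng (by omega) a5).2, io_ne b1, io_ne b2, io_ne b3,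
    io_ne b4, ?_⟩
  rw [io_W hw hW hI b1 (by omega) (by omega), io_W hw hW hI b2 (by omega) (by omega),
    io_W hw hW hI b3 (by omega) (by omega), io_W hw hW hI b4 (by omega) (by omega)]
  omega

theorem del4231 {m : ℕ} {d : ℤ} {w' W : Equiv.Perm ℤ} (hw : IsBn m w') (hW : IsBn (m + 1) W)
    (hI : Ins m d w' W) (h : LongAvoids4231 (m + 1) W) : LongAvoids4231 m w' := by
  rintro ⟨i1, i2, i3, i4, a1, a2, a3, a4, a5, b1, b2, b3, b4, c1, c2, c3⟩
  refine h ⟨io d i1, io d i2, io d i3, io d i4, (io_rng a1 (by omega)).1, io_mono b1 b2 a2,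
    io_mono b2 b3 a3, io_mono b3 b4 a4, (io_rng (by omega) a5).2, io_ne b1, io_ne b2, io_ne b3,
    io_ne b4, ?_⟩
  rw [io_W hw hW hI b1 (by omega) (by omega), io_W hw hW hI b2 (by omega) (by omega),
    io_W hw hW hI b3 (by omega) (by omega), io_W hw hW hI b4 (by omega) (by omega)]
  omega

theorem lt_top {M : ℕ} {w : Equiv.Perm ℤ} (hw : IsBn M w) {p i : ℤ} (hp : w p = M)
    (hi : |i| ≤ M) (hne : i ≠ p) : w i < M := by
  have h1 := hw.abs_le hi
  have h2 : w i ≠ M := fun h => hne (w.injective (h.trans hp.symm))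
  grind

theorem S_dec {M : ℕ} {w : Equiv.Perm ℤ} (hw : IsBn M w) (h42 : LongAvoids4231 M w) {p : ℤ}
    (hp1 : 1 ≤ p) (hp : w p = M) : Dec M p w ∨ ∃ i, p < i ∧ i < M ∧ w i < w M := by
  by_contra hc
  push Not at hc
  obtain ⟨hD, hS⟩ := hc
  apply hD
  intro i j hi hij hj
  by_contra hlt
  have hne : w i ≠ w j := fun h => by have := w.injective h; omega
  have hjp := lt_top hw hp (i := j) (by grind) (by omega)
  have hip : p < i := by
    rcases eq_or_lt_of_le hi with h | h
    · subst h; omega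
    · exact h
  have h1 := hS i hip (by omega)
  by_cases hjM : j = M
  · subst hjM; omega
  have hne2 : w i ≠ w M := fun h => by have := w.injective h; omega
  exact h42 ⟨p, i, j, M, by omega, hip, hij, by omega, le_rfl, by omega, by omega, by omega,
    by omega, by omega, by omega, by omega⟩

theorem S_neg {M : ℕ} {w : Equiv.Perm ℤ} (hw : IsBn M w) (h34 : LongAvoids3412 M w)
    (h42 : LongAvoids4231 M w) {p : ℤ}
    (hp1 : 1 ≤ p) (hp : w p = M) (he : w M < 0) : Dec M p w := by
  rcases S_dec hw h42 hp1 hp with h | ⟨i, h1, h2, h3⟩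
  · exact h
  exfalso
  have h4 := lt_top hw hp (i := -i) (by grind) (by omega)
  refine h34 ⟨-i, p, i, M, by omega, by omega, by omega, by omega, le_rfl, by omega, by omega, 
    by omega, by omega, h3, ?_, ?_⟩
  · rw [hw.1]; omega
  · rw [hp]; exact h4

theorem struct {M : ℕ} (hM : 1 ≤ M) {w : Equiv.Perm ℤ} (hw : IsBn M w) (h34 : LongAvoids3412 M w)
    (h42 : LongAvoids4231 M w) :
    (∀ i j : ℤ, i ≠ 0 → j ≠ 0 → -(M : ℤ) ≤ i → i < j → j ≤ M → w j < w i) ∨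
    (∃ p : ℤ, 1 ≤ p ∧ p ≤ M ∧ w p = M ∧ Dec M p w) ∨
    (∃ p : ℤ, 1 ≤ p ∧ p ≤ M ∧ w⁻¹ p = M ∧ Dec M p w⁻¹) := by
  have hb := hw.inv'
  have hM' : (1 : ℤ) ≤ M := by exact_mod_cast hM
  obtain ⟨p, hp⟩ : ∃ p, p = w⁻¹ M := ⟨_, rfl⟩
  obtain ⟨e, he⟩ : ∃ e, e = w M := ⟨_, rfl⟩
  have hp' : w p = M := by rw [hp, pvi]
  have he' : w⁻¹ e = M := by rw [he, piv]
  have hpr : |p| ≤ M := by rw [hp]; exact hb.abs_le (by simp)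
  have her : |e| ≤ M := by rw [he]; exact hw.abs_le (by simp)
  have hp0 : p ≠ 0 := by rw [hp]; exact odd_ne hb.1 (by omega)
  have he0 : e ≠ 0 := by rw [he]; exact odd_ne hw.1 (by omega)
  by_cases hpM : p = -M
  · left
    have heM : w M = -M := by
      rw [hpM, hw.1] at hp'; omega
    intro i j hi hj h1 h2 h3
    by_contra hlt
    have hne : w i ≠ w j := fun h => by have := w.injective h; omega
    have hjt := lt_top hw hp' (i := j) (by grind) (by omega)
    have hiM : i ≠ -M := fun h => by rw [h, ← hpM, hp'] at hlt; omega
    have hib := lt_top hw hp' (i := -i) (by grind) (by omega)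
    rw [hw.1] at hib
    have hjM : j ≠ M := fun h => by rw [h, heM] at hlt hne; omega
    exact h42 ⟨-M, i, j, M, le_rfl, by omega, h2, by omega, le_rfl, by omega, hi, hj, by omega,
      by omega, by omega, by rw [← hpM, hp']; exact hjt⟩
  · right
    rcases lt_or_gt_of_ne hp0 with hpn | hpp
    · rcases lt_or_gt_of_ne he0 with hen | hep
      · exfalso
        have h1 := lt_top hw hp' (i := -M) (by simp) (by omega)
        rw [hw.1, ← he] at h1
        refine h34 ⟨-M, p, -p, M, le_rfl, by grind, by omega, by grind, le_rfl, by omega, by omega,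
          by omega, by omega, ?_⟩
        rw [hw.1, hw.1, ← he, hp']; omega
      · right
        exact ⟨e, by omega, by grind, he', S_neg hb (inv3412 hw h34) (inv4231 hw h42) (by omega) he'
          (by rw [← hp]; exact hpn)⟩
    · rcases lt_or_gt_of_ne he0 with hen | hep
      · left
        exact ⟨p, by omega, by grind, hp', S_neg hw h34 h42 (by omega) hp'
          (by rw [← he]; exact hen)⟩
      · rcases S_dec hw h42 (by omega) hp' with h | ⟨i, a1, a2, a3⟩
        · left; exact ⟨p, by omega, by grind, hp', h⟩
        rcases S_dec hb (inv4231 hw h42) (by omega) he' with h | ⟨a, b1, b2, b3⟩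
        · right; exact ⟨e, by omega, by grind, he', h⟩
        exfalso
        rw [← hp] at b3
        have hk := hb.abs_le (i := a) (by grind)
        refine h34 ⟨w⁻¹ a, p, i, M, by grind, b3, a1, a2, le_rfl, odd_ne hb.1 (by omega), by omega,
          by omega, by omega, a3, ?_⟩
        rw [pvi, ← he, hp']; omega

theorem Dec_V {m : ℕ} {d : ℤ} {v' V : Equiv.Perm ℤ} (hv : IsBn m v') (hd : 1 ≤ d)
    (hI : Ins m d v' V) (hD : Dec m d v') : Dec (m + 1) d V := by
  intro i j h1 h2 h3
  push_cast at h3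
  rw [hI.2.2 j (by omega) h3]
  rcases eq_or_lt_of_le h1 with h | h
  · subst h
    rw [hI.2.1]
    have := hv.abs_le (i := j - 1) (by grind)
    grind
  · rw [hI.2.2 i h (by omega)]
    exact hD _ _ (by omega) (by omega) (by omega)

theorem Dec_W {m : ℕ} {d : ℤ} {v' V : Equiv.Perm ℤ}
    (hI : Ins m d v' V) (hD : Dec (m + 1) d V) : Dec m d v' := by
  intro i j h1 h2 h3
  have := hD (i + 1) (j + 1) (by omega) (by omega) (by push_cast; omega)
  rw [hI.2.2 _ (by omega) (by omega), hI.2.2 _ (by omega) (by omega)] at this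
  simpa using this

theorem Ins_at {m : ℕ} {d : ℤ} {v' V : Equiv.Perm ℤ} (hd : 1 ≤ d)
    (hI : Ins m d v' V) {i : ℤ} (h1 : 1 ≤ i) (h2 : i ≤ m + 1) (h : i ≠ d) :
    V i = v' (if i < d then i else i - 1) := by
  split_ifs with h3
  · exact hI.1 i h1 h3
  · exact hI.2.2 i (by omega) h2

theorem five {m : ℕ} {d : ℤ} {v' V : Equiv.Perm ℤ} (hv : IsBn m v') (hV : IsBn (m + 1) V)
    (hd : 1 ≤ d) (hdm : d ≤ m + 1)
    (hI : Ins m d v' V) (hD : Dec m d v') (hF : AvoidsFive m v') : AvoidsFive (m + 1) V := by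
  obtain ⟨f1, f2, f3, f4, f5⟩ := hF
  have hVD := Dec_V hv hd hI hD
  have hr : ∀ i : ℤ, 1 ≤ i → i ≤ m + 1 → -((m : ℤ) + 1) ≤ V i ∧ V i ≤ m + 1 := by
    intro i h1 h2
    have := hV.abs_le (i := i) (by push_cast; grind)
    push_cast at this; grind
  have hdd := hI.2.1
  refine ⟨?_, ?_, ?_, ?_, ?_⟩
  · rintro ⟨i, j, a1, a2, a3, b1, b2, b3⟩
    push_cast at a3
    have h1 := hr i a1 (by omega)
    have h2 := hr j (by omega) (by omega)
    have hi : i ≠ d := by rintro rfl; omega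
    have hj : j ≠ d := by rintro rfl; omega
    rw [Ins_at hd hI a1 (by omega) hi] at *
    rw [Ins_at hd hI (by omega) (by omega) hj] at *
    exact f1 ⟨_, _, by grind, by grind, by grind, b1, b2, b3⟩
  · rintro ⟨i, j, a1, a2, a3, b1, b2, b3⟩
    push_cast at a3
    have h1 := hr i a1 (by omega)
    have h2 := hr j (by omega) (by omega)
    have hi : i ≠ d := by rintro rfl; omega
    have hj : j ≠ d := by rintro rfl; omega
    rw [Ins_at hd hI a1 (by omega) hi] at *
    rw [Ins_at hd hI (by omega) (by omega) hj] at *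
    exact f2 ⟨_, _, by grind, by grind, by grind, b1, b2, b3⟩
  · rintro ⟨i, j, a1, a2, a3, b1, b2⟩
    push_cast at a3
    have h1 := hr i a1 (by omega)
    have h2 := hr j (by omega) (by omega)
    have hi : i ≠ d := by rintro rfl; omega
    have hj : j ≠ d := by rintro rfl; omega
    rw [Ins_at hd hI a1 (by omega) hi] at *
    rw [Ins_at hd hI (by omega) (by omega) hj] at *
    exact f3 ⟨_, _, by grind, by grind, by grind, b1, b2⟩
  · rintro ⟨i, j, k, a1, a2, a3, a4, b1, b2, b3⟩
    have a5 := a4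
    push_cast at a4
    have h1 := hr i a1 (by omega)
    have h2 := hr j (by omega) (by omega)
    have h3 := hr k (by omega) (by omega)
    have hi : i ≠ d := by rintro rfl; have := hVD j k (by omega) a3 a5; omega
    have hj : j ≠ d := by rintro rfl; omega
    have hk : k ≠ d := by rintro rfl; omega
    rw [Ins_at hd hI a1 (by omega) hi] at *
    rw [Ins_at hd hI (by omega) (by omega) hj] at *
    rw [Ins_at hd hI (by omega) (by omega) hk] at *
    exact f4 ⟨_, _, _, by grind, by grind, by grind, by grind, b1, b2, b3⟩
  · rintro ⟨i, j, k, a1, a2, a3, a4, b1, b2, b3, b4⟩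
    have a5 := a4
    push_cast at a4
    have h1 := hr i a1 (by omega)
    have h2 := hr j (by omega) (by omega)
    have h3 := hr k (by omega) (by omega)
    have hi : i ≠ d := by rintro rfl; have := hVD j k (by omega) a3 a5; omega
    have hj : j ≠ d := by rintro rfl; omega
    have hk : k ≠ d := by rintro rfl; omega
    rw [Ins_at hd hI a1 (by omega) hi] at *
    rw [Ins_at hd hI (by omega) (by omega) hj] at *
    rw [Ins_at hd hI (by omega) (by omega) hk] at *
    exact f5 ⟨_, _, _, by grind, by grind, by grind, by grind, b1, b2, b3, b4⟩

theorem mono_aux {M : ℕ} {w : Equiv.Perm ℤ} (hw : IsBn M w) {p d : ℤ} (hpM : p ≤ M)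
    (hp : w p = M) (hd : 1 ≤ d) (h : Dec M d w ∨ Dec M d w⁻¹) : p ≤ d := by
  by_contra hlt
  rcases h with h | h
  · have h1 := h d p le_rfl (by omega) hpM
    have h2 := hw.abs_le (i := d) (by grind)
    grind
  · have key : ∀ k : ℕ, d ≤ (M : ℤ) - k → p + k ≤ w⁻¹ ((M : ℤ) - k) := by
      intro k
      induction k with
      | zero => intro _; simp [← hp]
      | succ k ih =>
        intro hk
        push_cast at hk ⊢
        have h1 := ih (by omega)
        have h2 := h ((M : ℤ) - (k + 1)) ((M : ℤ) - k) (by omega) (by omega) (by omega)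
        omega
    have h1 := key ((M : ℤ) - d).toNat (by omega)
    rw [show (M : ℤ) - (((M : ℤ) - d).toNat : ℕ) = d by omega] at h1
    have h2 := hw.inv'.abs_le (i := d) (by grind)
    grind

/-- Inductive invariant. -/
def Good (m : ℕ) (w v : Equiv.Perm ℤ) : Prop :=
  IsBn m v ∧ AvoidsFive m v ∧
  (∃ (I : Type) (f g : I → Equiv.Perm ℤ), Function.Injective f ∧ Function.Injective g ∧
    Set.range f = {u | Le u w} ∧ Set.range g = {u | Le u v} ∧ ∀ x, Cj m (f x) (g x)) ∧
  ∀ d : ℤ, 1 ≤ d → (Dec m d w ∨ Dec m d w⁻¹) → Dec m d v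

theorem good_base {m : ℕ} {w : Equiv.Perm ℤ} (hw : IsBn m w)
    (h : ∀ i j : ℤ, i ≠ 0 → j ≠ 0 → -(m : ℤ) ≤ i → i < j → j ≤ m → w j < w i) : Good m w w := by
  have hneg : ∀ i : ℤ, 1 ≤ i → i ≤ m → w i < 0 := by
    intro i h1 h2
    have := h (-i) i (by omega) (by omega) (by omega) (by omega) h2
    rw [hw.1] at this; omega
  refine ⟨hw, ⟨?_, ?_, ?_, ?_, ?_⟩, ⟨{u // Le u w}, Subtype.val, Subtype.val,
    Subtype.val_injective, Subtype.val_injective, Subtype.range_val, Subtype.range_val,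
    fun x => Cj_refl _ _⟩, ?_⟩
  · rintro ⟨i, j, a1, a2, a3, b1, b2, b3⟩
    have := hneg i a1 (by omega); omega
  · rintro ⟨i, j, a1, a2, a3, b1, b2, b3⟩
    have := hneg j (by omega) (by omega); omega
  · rintro ⟨i, j, a1, a2, a3, b1, b2⟩
    have := h i j (by omega) (by omega) (by omega) a2 a3; omega
  · rintro ⟨i, j, k, a1, a2, a3, a4, b1, b2, b3⟩
    have := hneg j (by omega) (by omega); omega
  · rintro ⟨i, j, k, a1, a2, a3, a4, b1, b2, b3, b4⟩
    have := hneg k (by omega) (by omega); omega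
  · intro d hd _ i j h1 h2 h3
    exact h i j (by omega) (by omega) (by omega) h2 h3

theorem fact_inj {m : ℕ} {u u' : Equiv.Perm ℤ} (hu : IsBn m u) (hu' : IsBn m u') {i j : ℤ}
    (hi : 1 ≤ i) (hj : 1 ≤ j) (h : u * rf i (m + 1) = u' * rf j (m + 1)) : u = u' ∧ i = j := by
  have M0 : (m : ℤ) + 1 ≠ 0 := by omega
  have h1 : (u * rf i (m + 1)) i = m + 1 := by
    rw [Equiv.Perm.mul_apply, rf_left (by omega) M0, hu.2 _ (by grind)]
  have h2 : (u' * rf j (m + 1)) j = m + 1 := by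
    rw [Equiv.Perm.mul_apply, rf_left (by omega) M0, hu'.2 _ (by grind)]
  have e : i = j := by
    rw [h] at h1
    exact (u' * rf j (m + 1)).injective (h1.trans h2.symm)
  subst e
  exact ⟨mul_right_cancel h, rfl⟩

theorem keyK_left {n m : ℕ} (hmn : m + 1 ≤ n) {w' W : Equiv.Perm ℤ} (hw : IsBn m w')
    (hW : IsBn (m + 1) W) {d : ℤ} (h1 : 1 ≤ d) (h2 : d ≤ m + 1) (hI : Ins m d w' W⁻¹)
    (hD : Dec m d w') (u : Equiv.Perm ℤ) :
    Le u W ↔ ∃ i : ℤ, d ≤ i ∧ i ≤ m + 1 ∧ ∃ u', Le u' w'⁻¹ ∧ u = rf i (m + 1) * u' := by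
  have hk := keyK_d hmn hw hW.inv' h1 h2 hI hD
  have M0 : (m : ℤ) + 1 ≠ 0 := by omega
  constructor
  · intro h
    obtain ⟨i, a1, a2, u', a3, a4⟩ := (hk _).1 (Le_inv h hW)
    refine ⟨i, a1, a2, u'⁻¹, Le_inv a3 hw, ?_⟩
    rw [← inv_inv u, a4, mul_inv_rev, rf_inv (by omega) M0]
  · rintro ⟨i, a1, a2, u', a3, rfl⟩
    have h3 := Le_inv a3 hw.inv'
    rw [inv_inv] at h3
    have := Le_inv ((hk (u'⁻¹ * rf i (m + 1))).2 ⟨i, a1, a2, _, h3, rfl⟩) hW.inv'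
    rwa [mul_inv_rev, rf_inv (by omega) M0, inv_inv, inv_inv] at this

theorem good_step {n m : ℕ} (hmn : m + 1 ≤ n) {w w' v' : Equiv.Perm ℤ}
    (hw' : IsBn m w') {p : ℤ} (h1 : 1 ≤ p) (h2 : p ≤ m + 1)
    (hG : Good m w' v') (hD : Dec m p v')
    (hmono : ∀ d : ℤ, 1 ≤ d → (Dec (m + 1) d w ∨ Dec (m + 1) d w⁻¹) → p ≤ d)
    (F : Equiv.Perm ℤ → ℤ → Equiv.Perm ℤ)
    (hFi : ∀ u u' i j, IsBn m u → IsBn m u' → 1 ≤ i → 1 ≤ j → F u i = F u' j → u = u' ∧ i = j)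
    (hFr : ∀ u, Le u w ↔ ∃ i : ℤ, p ≤ i ∧ i ≤ m + 1 ∧ ∃ u', Le u' w' ∧ u = F u' i)
    (hFc : ∀ u i, IsBn m u → 1 ≤ i → Cj (m + 1) (F u i) (u * rf i (m + 1))) :
    ∃ v, Good (m + 1) w v := by
  obtain ⟨hv', hF5, ⟨I, f, g, fi, gi, fr, gr, hc⟩, -⟩ := hG
  obtain ⟨v, hv, hI⟩ := Ins_exists_d hv' h1 h2
  have hk := keyK_d hmn hv' hv h1 h2 hI hD
  have hf : ∀ x, Le (f x) w' := fun x => by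
    have : f x ∈ Set.range f := ⟨x, rfl⟩
    rwa [fr] at this
  have hg : ∀ x, Le (g x) v' := fun x => by
    have : g x ∈ Set.range g := ⟨x, rfl⟩
    rwa [gr] at this
  refine ⟨v, hv, five hv' hv h1 h2 hI hD hF5, ⟨I × Set.Icc p (m + 1 : ℤ), fun x => F (f x.1) x.2,
    fun x => g x.1 * rf x.2 (m + 1), ?_, ?_, ?_, ?_, ?_⟩, ?_⟩
  · rintro ⟨x, i, i1, i2⟩ ⟨y, j, j1, j2⟩ h
    obtain ⟨a, b⟩ := hFi _ _ _ _ (Le_Bn (hf x) hw') (Le_Bn (hf y) hw') (h1.trans i1) (h1.trans j1) h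
    have := fi a
    subst this; subst b; rfl
  · rintro ⟨x, i, i1, i2⟩ ⟨y, j, j1, j2⟩ h
    obtain ⟨a, b⟩ := fact_inj (Le_Bn (hg x) hv') (Le_Bn (hg y) hv') (h1.trans i1) (h1.trans j1) h
    have := gi a
    subst this; subst b; rfl
  · ext u
    simp only [Set.mem_range, Set.mem_setOf_eq]
    rw [hFr]
    constructor
    · rintro ⟨⟨x, i, i1, i2⟩, rfl⟩
      exact ⟨i, i1, i2, f x, hf x, rfl⟩
    · rintro ⟨i, i1, i2, u', a, rfl⟩
      have : u' ∈ Set.range f := by rw [fr]; exact a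
      obtain ⟨x, rfl⟩ := this
      exact ⟨⟨x, i, i1, i2⟩, rfl⟩
  · ext u
    simp only [Set.mem_range, Set.mem_setOf_eq]
    rw [hk]
    constructor
    · rintro ⟨⟨x, i, i1, i2⟩, rfl⟩
      exact ⟨i, i1, i2, g x, hg x, rfl⟩
    · rintro ⟨i, i1, i2, u', a, rfl⟩
      have : u' ∈ Set.range g := by rw [gr]; exact a
      obtain ⟨x, rfl⟩ := this
      exact ⟨⟨x, i, i1, i2⟩, rfl⟩
  · rintro ⟨x, i, i1, i2⟩
    have hB := Le_Bn (hf x) hw'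
    exact Cj_trans (hFc _ i hB (h1.trans i1)) (Cj_E1 (hc x) hB (h1.trans i1))
  · intro d hd hdd i j a1 a2 a3
    exact Dec_V hv' h1 hI hD i j ((hmono d hd hdd).trans a1) a2 a3

theorem main {n : ℕ} (m : ℕ) (hmn : m ≤ n) (w : Equiv.Perm ℤ) (hw : IsBn m w)
    (h34 : LongAvoids3412 m w) (h42 : LongAvoids4231 m w) : ∃ v, Good m w v := by
  induction m generalizing w with
  | zero => exact ⟨w, good_base hw (fun i j h1 h2 h3 h4 h5 => by simp at h3 h5; omega)⟩
  | succ m ih =>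
    have M0 : (m : ℤ) + 1 ≠ 0 := by omega
    rcases struct (by omega) hw h34 h42 with h | ⟨p, p1, p2, p3, p4⟩ | ⟨p, p1, p2, p3, p4⟩
    · exact ⟨w, good_base hw h⟩
    · have hm : ∀ d : ℤ, 1 ≤ d → (Dec (m + 1) d w ∨ Dec (m + 1) d w⁻¹) → p ≤ d :=
        fun d hd => mono_aux hw p2 p3 hd
      push_cast at p2 p3
      obtain ⟨w', hw', hI⟩ := Del_exists_d hw p1 p2 p3
      have hD := Dec_W hI p4
      obtain ⟨v', hG⟩ := ih (by omega) w' hw' (del3412 hw' hw hI h34) (del4231 hw' hw hI h42)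
      exact good_step hmn hw' p1 p2 hG (hG.2.2.2 p p1 (Or.inl hD)) hm
        (fun u i => u * rf i (m + 1)) (fun u u' i j a b c d e => fact_inj a b c d e)
        (keyK_d hmn hw' hw p1 p2 hI hD) (fun u i _ _ => Cj_refl _ _)
    · have hm : ∀ d : ℤ, 1 ≤ d → (Dec (m + 1) d w ∨ Dec (m + 1) d w⁻¹) → p ≤ d :=
        fun d hd h => mono_aux hw.inv' p2 p3 hd (by rw [inv_inv]; exact h.symm)
      push_cast at p2 p3
      obtain ⟨w', hw', hI⟩ := Del_exists_d hw.inv' p1 p2 p3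
      have hD := Dec_W hI p4
      obtain ⟨v', hG⟩ := ih (by omega) w'⁻¹ hw'.inv'
        (inv3412 hw' (del3412 hw' hw.inv' hI (inv3412 hw h34)))
        (inv4231 hw' (del4231 hw' hw.inv' hI (inv4231 hw h42)))
      refine good_step hmn hw'.inv' p1 p2 hG (hG.2.2.2 p p1 (Or.inr (by rwa [inv_inv]))) hm
        (fun u i => rf i (m + 1) * u) (fun u u' i j a b c d e => ?_)
        (keyK_left hmn hw' hw p1 p2 hI hD) (fun u i hu hi => Cj_E2 hu hi)
      have e' := congrArg (·⁻¹) e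
      simp only [mul_inv_rev, rf_inv (show i ≠ 0 by omega) M0, rf_inv (show j ≠ 0 by omega) M0] at e'
      have := fact_inj a.inv' b.inv' c d e'
      exact ⟨inv_injective this.1, this.2⟩

end BH

/-- For every `w ∈ B_n` whose long one-line notation avoids `3412` and
`4231`, there exists `v ∈ B_n` whose window avoids the five signed patterns such that the
Kazhdan–Lusztig elements `C'_w(1)` and `C'_v(1)` agree under every trace of `ℤ[B_n]`:
for every conjugation-invariant `θ : B_n → ℂ`,
`Σ_{u ≤ w} θ(u) = Σ_{u ≤ v} θ(u)` over Bruhat intervals. -/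
theorem stmt_8 (n : ℕ) (hn : 1 ≤ n) (w : Equiv.Perm ℤ) (hw : IsBn n w)
    (h34 : LongAvoids3412 n w) (h42 : LongAvoids4231 n w) :
    ∃ v : Equiv.Perm ℤ, IsBn n v ∧ AvoidsFive n v ∧
      ∀ θ : Equiv.Perm ℤ → ℂ,
        (∀ x u : Equiv.Perm ℤ, IsBn n x → IsBn n u → θ (x * u * x⁻¹) = θ u) →
        (∑ᶠ u ∈ {u : Equiv.Perm ℤ | IsBn n u ∧ BruhatLe (bGen n) u w}, θ u)
          = ∑ᶠ u ∈ {u : Equiv.Perm ℤ | IsBn n u ∧ BruhatLe (bGen n) u v}, θ u := by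
  obtain ⟨v, hv, h5, ⟨I, f, g, fi, gi, fr, gr, hc⟩, -⟩ := BH.main (n := n) n le_rfl w hw h34 h42
  refine ⟨v, hv, h5, fun θ hθ => ?_⟩
  have e1 : {u : Equiv.Perm ℤ | IsBn n u ∧ BruhatLe (bGen n) u w} = Set.range f := by
    rw [fr]; ext u; exact BH.bruhat_iff hn hw
  have e2 : {u : Equiv.Perm ℤ | IsBn n u ∧ BruhatLe (bGen n) u v} = Set.range g := by
    rw [gr]; ext u; exact BH.bruhat_iff hn hv
  rw [e1, e2, finsum_mem_range fi, finsum_mem_range gi]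
  refine finsum_congr fun x => ?_
  obtain ⟨y, y1, y2, -⟩ := hc x
  have hB : IsBn n (f x) := by
    have : f x ∈ Set.range f := ⟨x, rfl⟩
    rw [fr] at this
    exact BH.Le_Bn this hw
  rw [← hθ y (f x) y1 hB, y2, mul_assoc, mul_inv_cancel, mul_one]
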